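/- Let l1, l2, l3, l4 be integers, each at least 2. Then ζ(l1)ζ(l2)ζ(l3)ζ(l4) = Σ_{σ ∈ S4} ζ(l_{σ(1)}, l_{σ(2)}, l_{σ(3)}, l_{σ(4)}) + Σ_{σ ∈ A4} [ζ(l_{σ(1)}+l_{σ(2)}, l_{σ(3)}, l_{σ(4)}) + ζ(l_{σ(1)}, l_{σ(2)}+l_{σ(3)}, l_{σ(4)}) + ζ(l_{σ(1)}, l_{σ(2)}, l_{σ(3)}+l_{σ(4)})] + Σ_{σ ∈ X4} ζ(l_{σ(1)}+l_{σ(2)}, l_{σ(3)}+l_{σ(4)}) + Σ_{σ ∈ C4} [ζ(l_{σ(1)}+l_{σ(2)}+l_{σ(3)}, l_{σ(4)}) + ζ(l_{σ(1)}, l_{σ(2)}+l_{σ(3)}+l_{σ(4)})] + ζ(l1+l2+l3+l4). Here S4 is the full symmetric group on {1,2,3,4}, A4 the alternating group, C4 = {id, (1234), (13)(24), (1432)} the cyclic group generated by the 4-cycle (1234), and X4 = C4 ∪ {(14), (23)} (a set closed under inversion, so the orientation of σ is immaterial). (Fourth identity of Proposition 3 (harmonic relations in depth 4) of the paper, restricted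 to convergent indices.) -/

import Mathlib

open Classical in
/-- The multiple zeta value `ζ(l 0, l 1, …, l (n-1)) =
∑_{m 0 > m 1 > ⋯ > m (n-1) ≥ 1} ∏ i, 1 / (m i) ^ (l i)`. -/
noncomputable def mzv {n : ℕ} (l : Fin n → ℕ) : ℝ :=
  ∑' m : Fin n → ℕ,
    if StrictAnti m ∧ ∀ i, 1 ≤ m i then ∏ i, (1 : ℝ) / (m i : ℝ) ^ (l i) else 0

/-- The 4-cycle `(1234)` (on `{1,2,3,4}`, written 0-based as `0 ↦ 1 ↦ 2 ↦ 3 ↦ 0`). -/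
def c₄ : Equiv.Perm (Fin 4) := Equiv.swap 0 1 * Equiv.swap 1 2 * Equiv.swap 2 3

/-- The cyclic group `C4 = {id, (1234), (13)(24), (1432)}` as a finset. -/
def C4 : Finset (Equiv.Perm (Fin 4)) := {1, c₄, c₄ ^ 2, c₄ ^ 3}

/-- `X4 = C4 ∪ {(14), (23)}`. -/
def X4 : Finset (Equiv.Perm (Fin 4)) :=
  {1, c₄, c₄ ^ 2, c₄ ^ 3, Equiv.swap 0 3, Equiv.swap 1 2}

/-- The alternating group `A4` as a finset: the even permutations of `Fin 4`. -/
def A4 : Finset (Equiv.Perm (Fin 4)) :=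
  Finset.univ.filter fun σ => Equiv.Perm.sign σ = 1

/-- The exponents obtained from `l` by adding up those lying in the same fibre of `t`. -/
def fiberSum {n k : ℕ} (l : Fin n → ℕ) (t : Fin n → Fin k) : Fin k → ℕ :=
  fun j => ∑ i with t i = j, l i

theorem mzv_eq_tsum_strictAnti {n : ℕ} {l : Fin n → ℕ} (hl : ∀ i, l i ≠ 0) :
    mzv l = ∑' m : {m : Fin n → ℕ | StrictAnti m}, ∏ i, (1 : ℝ) / (m.1 i : ℝ) ^ l i := by
  rw [tsum_subtype {m : Fin n → ℕ | StrictAnti m}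
    (fun m => ∏ i, (1 : ℝ) / (m i : ℝ) ^ l i), mzv]
  refine tsum_congr fun m => ?_
  by_cases hm : StrictAnti m
  · rw [Set.indicator_of_mem (by exact hm)]
    split_ifs with h
    · rfl
    · obtain ⟨i, hi⟩ : ∃ i, m i = 0 := by
        by_contra! h'
        exact h ⟨hm, fun i => Nat.one_le_iff_ne_zero.2 (h' i)⟩
      exact (Finset.prod_eq_zero (Finset.mem_univ i) (by simp [hi, hl i])).symm
  · rw [Set.indicator_of_notMem (by exact hm), if_neg fun h => hm h.1]

theorem mzv_depth_one {l : ℕ} (hl : l ≠ 0) :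
    mzv ![l] = ∑' m : ℕ, (1 : ℝ) / (m : ℝ) ^ l := by
  rw [mzv, ← (Equiv.funUnique (Fin 1) ℕ).symm.tsum_eq]
  refine tsum_congr fun m => ?_
  rcases Nat.eq_zero_or_pos m with rfl | hm
  · simp [hl]
  · rw [if_pos ⟨Subsingleton.strictAnti _, fun _ => hm⟩]
    simp

/-- A tuple of natural numbers is the composition of the strictly decreasing enumeration of its
values with a surjection. -/
theorem bijective_strictAnti_comp_surjective (n : ℕ) :
    Function.Bijective
      (fun x : Σ y : Σ k : Fin (n + 1), {t : Fin n → Fin k // Function.Surjective t},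
        {m : Fin y.1 → ℕ | StrictAnti m} => (x.2.1 ∘ x.1.2.1 : Fin n → ℕ)) := by
  constructor
  · rintro ⟨⟨⟨k, hk⟩, t, ht⟩, m, hm⟩ ⟨⟨⟨k', hk'⟩, t', ht'⟩, m', hm'⟩ h
    have hr : Set.range m = Set.range m' := by
      have := congrArg Set.range h
      simpa only [ht.range_comp, ht'.range_comp] using this
    obtain rfl : k = k' := by
      have h1 := Set.ncard_range_of_injective hm.injective
      have h2 := Set.ncard_range_of_injective hm'.injective
      rw [hr, h2] at h1
      simpa using h1.symm
    obtain rfl : m = m' := (StrictAnti.range_inj hm hm').1 hr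
    obtain rfl : t = t' := hm.injective.comp_left h
    rfl
  · intro f
    let s : Finset ℕᵒᵈ := Finset.univ.image f
    have hs : s.card < n + 1 :=
      Nat.lt_succ_of_le (Finset.card_image_le.trans_eq (Finset.card_fin n))
    have hmem (i : Fin n) : ∃ j, s.orderEmbOfFin rfl j = f i := by
      have : f i ∈ Set.range (s.orderEmbOfFin rfl) := by
        rw [Finset.range_orderEmbOfFin]
        exact Finset.mem_coe.2 (Finset.mem_image_of_mem f (Finset.mem_univ i))
      exact this
    choose t ht using hmem
    refine ⟨⟨⟨⟨s.card, hs⟩, t, fun j => ?_⟩, s.orderEmbOfFin rfl,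
      fun a b hab => (s.orderEmbOfFin rfl).strictMono hab⟩, funext ht⟩
    obtain ⟨i, -, hi⟩ := Finset.mem_image.1 (s.orderEmbOfFin_mem rfl j)
    exact ⟨i, (s.orderEmbOfFin rfl).injective ((ht i).trans hi)⟩

theorem prod_one_div_pow_comp {n k : ℕ} (l : Fin n → ℕ) (t : Fin n → Fin k) (m : Fin k → ℕ) :
    ∏ i, (1 : ℝ) / ((m ∘ t) i : ℝ) ^ l i = ∏ j, (1 : ℝ) / (m j : ℝ) ^ fiberSum l t j := by
  rw [← Finset.prod_fiberwise Finset.univ t]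
  refine Finset.prod_congr rfl fun j _ => ?_
  rw [fiberSum, ← one_div_pow, ← Finset.prod_pow_eq_pow_sum]
  refine Finset.prod_congr rfl fun i hi => ?_
  rw [Function.comp_apply, (Finset.mem_filter.1 hi).2, one_div_pow]

theorem summable_and_tsum_prod {n : ℕ} {l : Fin n → ℕ} (hl : ∀ i, 2 ≤ l i) :
    (Summable fun m : Fin n → ℕ => ∏ i, (1 : ℝ) / (m i : ℝ) ^ l i) ∧
      ∑' m : Fin n → ℕ, ∏ i, (1 : ℝ) / (m i : ℝ) ^ l i =
        ∏ i, ∑' m : ℕ, (1 : ℝ) / (m : ℝ) ^ l i := by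
  induction n with
  | zero => exact ⟨(hasSum_fintype _).summable, by simp⟩
  | succ n ih =>
    obtain ⟨hs, ht⟩ := ih (l := fun i => l i.succ) fun i => hl _
    have h0 : Summable fun m : ℕ => (1 : ℝ) / (m : ℝ) ^ l 0 :=
      Real.summable_one_div_nat_pow.2 (hl 0)
    constructor
    · rw [← (Fin.consEquiv fun _ => ℕ).summable_iff]
      simpa [Function.comp_def, Fin.prod_univ_succ, Fin.consEquiv, mul_comm] using
        summable_mul_of_summable_norm h0.norm hs.norm
    · rw [← (Fin.consEquiv fun _ => ℕ).tsum_eq, Fin.prod_univ_succ, ← ht,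
        tsum_mul_tsum_of_summable_norm h0.norm hs.norm]
      simp [Fin.prod_univ_succ, Fin.consEquiv, mul_comm]

/-- The harmonic (quasi-shuffle) product of `n` zeta values. -/
theorem prod_mzv_depth_one {n : ℕ} {l : Fin n → ℕ} (hl : ∀ i, 2 ≤ l i) :
    ∏ i, mzv ![l i] =
      ∑ k : Fin (n + 1), ∑ t : Fin n → Fin k with Function.Surjective t, mzv (fiberSum l t) := by
  obtain ⟨hs, ht⟩ := summable_and_tsum_prod hl
  have hl0 (i : Fin n) : l i ≠ 0 := (Nat.zero_lt_of_lt (hl i)).ne'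
  let e := Equiv.ofBijective _ (bijective_strictAnti_comp_surjective n)
  simp_rw [mzv_depth_one (hl0 _)]
  rw [← ht, ← e.tsum_eq]
  refine (e.summable_iff.2 hs).tsum_sigma.trans ?_
  rw [tsum_fintype, Fintype.sum_sigma]
  refine Finset.sum_congr rfl fun k _ => ?_
  rw [← Finset.sum_subtype_eq_sum_filter, Finset.subtype_univ]
  refine Finset.sum_congr rfl fun t _ => ?_
  rw [mzv_eq_tsum_strictAnti]
  · exact tsum_congr fun m => prod_one_div_pow_comp l t.1 m.1
  · intro j
    obtain ⟨i, hi⟩ := t.2 j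
    exact (Finset.sum_pos' (fun _ _ => Nat.zero_le _)
      ⟨i, by simpa using hi, Nat.pos_of_ne_zero (hl0 i)⟩).ne'

theorem fiberSum_comp_symm {n k : ℕ} (l : Fin n → ℕ) (p : Fin n → Fin k)
    (σ : Equiv.Perm (Fin n)) : fiberSum l (p ∘ σ.symm) = fiberSum (l ∘ σ) p := by
  funext j
  simp only [fiberSum, Finset.sum_filter]
  exact (Equiv.sum_comp σ _).symm.trans (by simp)

theorem surjections_four_one :
    (Finset.univ.filter fun t : Fin 4 → Fin 1 => Function.Surjective t) = {![0, 0, 0, 0]} := by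
  decide

theorem surjections_four_two :
    (Finset.univ.filter fun t : Fin 4 → Fin 2 => Function.Surjective t).val =
      (X4.val.map fun σ : Equiv.Perm (Fin 4) => ![0, 0, 1, 1] ∘ σ.symm)
        + (C4.val.map fun σ : Equiv.Perm (Fin 4) => ![0, 0, 0, 1] ∘ σ.symm)
        + (C4.val.map fun σ : Equiv.Perm (Fin 4) => ![0, 1, 1, 1] ∘ σ.symm) := by
  decide +kernel

theorem surjections_four_three :
    (Finset.univ.filter fun t : Fin 4 → Fin 3 => Function.Surjective t).val =
      (A4.val.map fun σ : Equiv.Perm (Fin 4) => ![0, 0, 1, 2] ∘ σ.symm)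
        + (A4.val.map fun σ : Equiv.Perm (Fin 4) => ![0, 1, 1, 2] ∘ σ.symm)
        + (A4.val.map fun σ : Equiv.Perm (Fin 4) => ![0, 1, 2, 2] ∘ σ.symm) := by
  decide +kernel

theorem sum_surjective_fin_self {n : ℕ} (f : (Fin n → Fin n) → ℝ) :
    ∑ t : Fin n → Fin n with Function.Surjective t, f t =
      ∑ σ : Equiv.Perm (Fin n), f (id ∘ σ.symm) := by
  symm
  refine Finset.sum_bij (fun σ _ => σ.symm) (by simp [Equiv.surjective])
    (fun σ _ τ _ h => Equiv.symm_bijective.injective (DFunLike.coe_injective h))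
    (fun t ht => ?_) (fun _ _ => rfl)
  exact ⟨(Equiv.ofBijective t
    (Finite.injective_iff_bijective.1
      (Finite.injective_iff_surjective.2 (Finset.mem_filter.1 ht).2))).symm,
    Finset.mem_univ _, rfl⟩

theorem harmonic_relation_depth_four_fourth (l1 l2 l3 l4 : ℕ)
    (h1 : 2 ≤ l1) (h2 : 2 ≤ l2) (h3 : 2 ≤ l3) (h4 : 2 ≤ l4) :
    mzv ![l1] * mzv ![l2] * mzv ![l3] * mzv ![l4] =
      (∑ σ : Equiv.Perm (Fin 4), mzv (![l1, l2, l3, l4] ∘ σ))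
        + (∑ σ ∈ A4,
            (mzv ![![l1, l2, l3, l4] (σ 0) + ![l1, l2, l3, l4] (σ 1),
                   ![l1, l2, l3, l4] (σ 2), ![l1, l2, l3, l4] (σ 3)]
              + mzv ![![l1, l2, l3, l4] (σ 0),
                      ![l1, l2, l3, l4] (σ 1) + ![l1, l2, l3, l4] (σ 2),
                      ![l1, l2, l3, l4] (σ 3)]
              + mzv ![![l1, l2, l3, l4] (σ 0), ![l1, l2, l3, l4] (σ 1),
                      ![l1, l2, l3, l4] (σ 2) + ![l1, l2, l3, l4] (σ 3)]))
        + (∑ σ ∈ X4,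
            mzv ![![l1, l2, l3, l4] (σ 0) + ![l1, l2, l3, l4] (σ 1),
                  ![l1, l2, l3, l4] (σ 2) + ![l1, l2, l3, l4] (σ 3)])
        + (∑ σ ∈ C4,
            (mzv ![![l1, l2, l3, l4] (σ 0) + ![l1, l2, l3, l4] (σ 1)
                    + ![l1, l2, l3, l4] (σ 2), ![l1, l2, l3, l4] (σ 3)]
              + mzv ![![l1, l2, l3, l4] (σ 0),
                      ![l1, l2, l3, l4] (σ 1) + ![l1, l2, l3, l4] (σ 2)
                        + ![l1, l2, l3, l4] (σ 3)]))
        + mzv ![l1 + l2 + l3 + l4] := by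
  have hmul := prod_mzv_depth_one (l := ![l1, l2, l3, l4])
    (by simp [Fin.forall_fin_succ, h1, h2, h3, h4])
  have hzero : (Finset.univ.filter fun t : Fin 4 → Fin 0 => Function.Surjective t) = ∅ := by
    decide
  have h22 (l : Fin 4 → ℕ) : fiberSum l ![(0 : Fin 2), 0, 1, 1] = ![l 0 + l 1, l 2 + l 3] := by
    funext j; fin_cases j <;> simp [fiberSum, Finset.sum_filter, Fin.sum_univ_four]
  have h31 (l : Fin 4 → ℕ) : fiberSum l ![(0 : Fin 2), 0, 0, 1] = ![l 0 + l 1 + l 2, l 3] := by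
    funext j; fin_cases j <;> simp [fiberSum, Finset.sum_filter, Fin.sum_univ_four]
  have h13 (l : Fin 4 → ℕ) : fiberSum l ![(0 : Fin 2), 1, 1, 1] = ![l 0, l 1 + l 2 + l 3] := by
    funext j; fin_cases j <;> simp [fiberSum, Finset.sum_filter, Fin.sum_univ_four]
  have h211 (l : Fin 4 → ℕ) :
      fiberSum l ![(0 : Fin 3), 0, 1, 2] = ![l 0 + l 1, l 2, l 3] := by
    funext j; fin_cases j <;> simp [fiberSum, Finset.sum_filter, Fin.sum_univ_four]
  have h121 (l : Fin 4 → ℕ) :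
      fiberSum l ![(0 : Fin 3), 1, 1, 2] = ![l 0, l 1 + l 2, l 3] := by
    funext j; fin_cases j <;> simp [fiberSum, Finset.sum_filter, Fin.sum_univ_four]
  have h112 (l : Fin 4 → ℕ) :
      fiberSum l ![(0 : Fin 3), 1, 2, 2] = ![l 0, l 1, l 2 + l 3] := by
    funext j; fin_cases j <;> simp [fiberSum, Finset.sum_filter, Fin.sum_univ_four]
  have h4' (l : Fin 4 → ℕ) : fiberSum l ![(0 : Fin 1), 0, 0, 0] = ![l 0 + l 1 + l 2 + l 3] := by
    funext j; fin_cases j; simp [fiberSum, Finset.sum_filter, Fin.sum_univ_four]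
  have hid (l : Fin 4 → ℕ) : fiberSum l id = l := by
    funext j; simp [fiberSum, Finset.filter_eq']
  have hone : ∑ t : Fin 4 → Fin 1 with Function.Surjective t,
      mzv (fiberSum ![l1, l2, l3, l4] t) = mzv ![l1 + l2 + l3 + l4] := by
    rw [surjections_four_one, Finset.sum_singleton, h4']
    rfl
  have htwo (l : Fin 4 → ℕ) :
      ∑ t : Fin 4 → Fin 2 with Function.Surjective t, mzv (fiberSum l t) =
        (∑ σ ∈ X4, mzv ![l (σ 0) + l (σ 1), l (σ 2) + l (σ 3)])
          + (∑ σ ∈ C4, mzv ![l (σ 0) + l (σ 1) + l (σ 2), l (σ 3)])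
          + ∑ σ ∈ C4, mzv ![l (σ 0), l (σ 1) + l (σ 2) + l (σ 3)] := by
    rw [Finset.sum, surjections_four_two]
    simp only [Multiset.map_add, Multiset.sum_add, Multiset.map_map, Function.comp_apply,
      fiberSum_comp_symm, h22, h31, h13]
    rfl
  have hthree (l : Fin 4 → ℕ) :
      ∑ t : Fin 4 → Fin 3 with Function.Surjective t, mzv (fiberSum l t) =
        (∑ σ ∈ A4, mzv ![l (σ 0) + l (σ 1), l (σ 2), l (σ 3)])
          + (∑ σ ∈ A4, mzv ![l (σ 0), l (σ 1) + l (σ 2), l (σ 3)])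
          + ∑ σ ∈ A4, mzv ![l (σ 0), l (σ 1), l (σ 2) + l (σ 3)] := by
    rw [Finset.sum, surjections_four_three]
    simp only [Multiset.map_add, Multiset.sum_add, Multiset.map_map, Function.comp_apply,
      fiberSum_comp_symm, h211, h121, h112]
    rfl
  have hfour (l : Fin 4 → ℕ) :
      ∑ t : Fin 4 → Fin 4 with Function.Surjective t, mzv (fiberSum l t) =
        ∑ σ : Equiv.Perm (Fin 4), mzv (l ∘ σ) := by
    simp only [sum_surjective_fin_self, fiberSum_comp_symm, hid]
  rw [Fin.prod_univ_four] at hmul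
  refine (hmul.trans (Fin.sum_univ_five _)).trans ?_
  change (∑ t : Fin 4 → Fin 0 with Function.Surjective t, mzv (fiberSum ![l1, l2, l3, l4] t))
    + (∑ t : Fin 4 → Fin 1 with Function.Surjective t, mzv (fiberSum ![l1, l2, l3, l4] t))
    + (∑ t : Fin 4 → Fin 2 with Function.Surjective t, mzv (fiberSum ![l1, l2, l3, l4] t))
    + (∑ t : Fin 4 → Fin 3 with Function.Surjective t, mzv (fiberSum ![l1, l2, l3, l4] t))
    + (∑ t : Fin 4 → Fin 4 with Function.Surjective t, mzv (fiberSum ![l1, l2, l3, l4] t)) = _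
  rw [hzero, Finset.sum_empty, hone, htwo, hthree, hfour]
  simp only [Finset.sum_add_distrib]
  ring
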